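/- arXiv:2110.06085 — 4 statements merged into one kernel-verified Lean document; each statement's English description precedes it below -/
import Mathlib

section
/- The energy E attains a unique global minimizer x* ∈ (ℝ^d)^N, and x* is characterized by the stationarity equations: for every i, (I + Σ_{j≠i} w_{ij}) x*_i = z_i + Σ_{j≠i} w_{ij} x*_j. Moreover each matrix I + Σ_{j≠i} w_{ij} is positive definite, hence invertible, so x*_i = (I + Σ_{j≠i} w_{ij})⁻¹ (z_i + Σ_{j≠i} w_{ij} x*_j) for every i (Eqs. (7)–(8) of the paper). -/
open Matrix Finset

/-- The continuous quadratic energy of the point cloud features: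
`E(x) = Σ_i ‖x_i − z_i‖² + (1/2) Σ_{i≠j} (x_i − x_j)ᵀ w_{ij} (x_i − x_j)`. -/
noncomputable def energy {N d : ℕ} (z : Fin N → Fin d → ℝ)
    (w : Fin N → Fin N → Matrix (Fin d) (Fin d) ℝ)
    (x : Fin N → Fin d → ℝ) : ℝ :=
  ∑ i, (x i - z i) ⬝ᵥ (x i - z i) +
    (1 / 2 : ℝ) * ∑ i, ∑ j ∈ univ.erase i, (x i - x j) ⬝ᵥ (w i j) *ᵥ (x i - x j)

/-- The stationarity operator. -/
noncomputable def statOp {N d : ℕ} (w : Fin N → Fin N → Matrix (Fin d) (Fin d) ℝ) :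
    (Fin N → Fin d → ℝ) →ₗ[ℝ] (Fin N → Fin d → ℝ) where
  toFun x := fun i => x i + ∑ j, w i j *ᵥ (x i - x j)
  map_add' x y := by
    funext i
    simp only [Pi.add_apply, add_sub_add_comm, mulVec_add, sum_add_distrib]
    abel
  map_smul' c x := by
    funext i
    simp only [Pi.smul_apply, ← smul_sub, mulVec_smul, ← smul_sum, smul_add, RingHom.id_apply]

lemma energy_eq {N d : ℕ} (z : Fin N → Fin d → ℝ)
    (w : Fin N → Fin N → Matrix (Fin d) (Fin d) ℝ) (x : Fin N → Fin d → ℝ) :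
    energy z w x = ∑ i, (x i - z i) ⬝ᵥ (x i - z i) +
      (1 / 2 : ℝ) * ∑ i, ∑ j, (x i - x j) ⬝ᵥ (w i j) *ᵥ (x i - x j) := by
  unfold energy
  congr 2
  refine sum_congr rfl fun i _ => ?_
  exact sum_erase _ (by simp)

lemma cross_sum {N d : ℕ} (w : Fin N → Fin N → Matrix (Fin d) (Fin d) ℝ)
    (hsymm : ∀ i j, w i j = w j i) (x h : Fin N → Fin d → ℝ) :
    ∑ i, ∑ j, (h i - h j) ⬝ᵥ (w i j) *ᵥ (x i - x j) =
      2 * ∑ i, ∑ j, h i ⬝ᵥ (w i j) *ᵥ (x i - x j) := by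
  have h1 : ∑ i, ∑ j, h j ⬝ᵥ (w i j) *ᵥ (x i - x j) =
      - ∑ i, ∑ j, h i ⬝ᵥ (w i j) *ᵥ (x i - x j) := by
    rw [sum_comm, ← sum_neg_distrib]
    refine sum_congr rfl fun i _ => ?_
    rw [← sum_neg_distrib]
    refine sum_congr rfl fun j _ => ?_
    rw [hsymm j i, ← neg_sub (x i), mulVec_neg, dotProduct_neg]
  simp only [sub_dotProduct, sum_sub_distrib, h1]
  ring

lemma energy_zero_eq {N d : ℕ} (w : Fin N → Fin N → Matrix (Fin d) (Fin d) ℝ)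
    (hsymm : ∀ i j, w i j = w j i) (h : Fin N → Fin d → ℝ) :
    energy 0 w h = ∑ i, h i ⬝ᵥ statOp w h i := by
  rw [energy_eq, cross_sum w hsymm]
  simp [statOp, dotProduct_add, sum_add_distrib, dotProduct_sum]

lemma energy_add {N d : ℕ} (z : Fin N → Fin d → ℝ)
    (w : Fin N → Fin N → Matrix (Fin d) (Fin d) ℝ)
    (hpsd : ∀ i j, i ≠ j → (w i j).PosSemidef)
    (hsymm : ∀ i j, w i j = w j i) (x h : Fin N → Fin d → ℝ) :
    energy z w (x + h) = energy z w x + 2 * ∑ i, h i ⬝ᵥ (statOp w x i - z i) +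
      energy 0 w h := by
  have hc : ∑ i, h i ⬝ᵥ (statOp w x i - z i) = ∑ i, h i ⬝ᵥ (x i - z i) +
      (1 / 2 : ℝ) * ∑ i, ∑ j, (h i - h j) ⬝ᵥ (w i j) *ᵥ (x i - x j) := by
    rw [cross_sum w hsymm]
    simp only [statOp, LinearMap.coe_mk, AddHom.coe_mk, dotProduct_add, dotProduct_sub,
      sum_add_distrib, dotProduct_sum, sum_sub_distrib, mulVec_sub]
    ring
  have e1 : ∀ i, ((x + h) i - z i) ⬝ᵥ ((x + h) i - z i) =
      (x i - z i) ⬝ᵥ (x i - z i) + 2 * (h i ⬝ᵥ (x i - z i)) + h i ⬝ᵥ h i := by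
    intro i
    have : (x + h) i - z i = (x i - z i) + h i := by simp only [Pi.add_apply]; abel
    rw [this, add_dotProduct, dotProduct_add, dotProduct_add, dotProduct_comm (x i - z i) (h i)]
    ring
  have e2 : ∀ i j, ((x + h) i - (x + h) j) ⬝ᵥ (w i j) *ᵥ ((x + h) i - (x + h) j) =
      (x i - x j) ⬝ᵥ (w i j) *ᵥ (x i - x j) + 2 * ((h i - h j) ⬝ᵥ (w i j) *ᵥ (x i - x j))
      + (h i - h j) ⬝ᵥ (w i j) *ᵥ (h i - h j) := by
    intro i j
    by_cases hij : i = j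
    · subst hij; simp
    have ht : (w i j)ᵀ = w i j := by
      have := (hpsd i j hij).isHermitian.eq
      rwa [conjTranspose_eq_transpose_of_trivial] at this
    have hs : (x i - x j) ⬝ᵥ (w i j) *ᵥ (h i - h j) =
        (h i - h j) ⬝ᵥ (w i j) *ᵥ (x i - x j) := by
      rw [dotProduct_comm, dotProduct_mulVec, ← mulVec_transpose, ht, dotProduct_comm,
        dotProduct_comm]
    have : (x + h) i - (x + h) j = (x i - x j) + (h i - h j) := by
      simp only [Pi.add_apply]; abel
    rw [this, add_dotProduct, mulVec_add, dotProduct_add, dotProduct_add, hs]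
    ring
  rw [hc, energy_eq, energy_eq, energy_eq]
  simp only [e1, e2, sum_add_distrib, ← mul_sum, Pi.zero_apply, sub_zero]
  ring

lemma energy_zero_ge {N d : ℕ} (w : Fin N → Fin N → Matrix (Fin d) (Fin d) ℝ)
    (hpsd : ∀ i j, i ≠ j → (w i j).PosSemidef) (h : Fin N → Fin d → ℝ) :
    ∑ i, h i ⬝ᵥ h i ≤ energy 0 w h := by
  unfold energy
  have : 0 ≤ ∑ i, ∑ j ∈ univ.erase i, (h i - h j) ⬝ᵥ (w i j) *ᵥ (h i - h j) := by
    refine sum_nonneg fun i _ => sum_nonneg fun j hj => ?_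
    have := (hpsd i j (ne_of_mem_erase hj).symm).dotProduct_mulVec_nonneg (h i - h j)
    simpa using this
  simp only [Pi.zero_apply, sub_zero]
  linarith

lemma dot_nonneg {d : ℕ} (v : Fin d → ℝ) : 0 ≤ v ⬝ᵥ v :=
  sum_nonneg fun i _ => mul_self_nonneg (v i)

lemma energy_zero_nonneg {N d : ℕ} (w : Fin N → Fin N → Matrix (Fin d) (Fin d) ℝ)
    (hpsd : ∀ i j, i ≠ j → (w i j).PosSemidef) (h : Fin N → Fin d → ℝ) :
    0 ≤ energy 0 w h :=
  (sum_nonneg fun i _ => dot_nonneg (h i)).trans (energy_zero_ge w hpsd h)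

lemma eq_zero_of_energy {N d : ℕ} (w : Fin N → Fin N → Matrix (Fin d) (Fin d) ℝ)
    (hpsd : ∀ i j, i ≠ j → (w i j).PosSemidef) (h : Fin N → Fin d → ℝ)
    (h0 : energy 0 w h ≤ 0) : h = 0 := by
  have h1 := (energy_zero_ge w hpsd h).trans h0
  have h2 : ∑ i, h i ⬝ᵥ h i = 0 := le_antisymm h1 (sum_nonneg fun i _ => dot_nonneg (h i))
  rw [sum_eq_zero_iff_of_nonneg fun i _ => dot_nonneg (h i)] at h2
  funext i
  exact dotProduct_self_eq_zero.mp (h2 i (mem_univ i))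

lemma statOp_iff {N d : ℕ} (z : Fin N → Fin d → ℝ)
    (w : Fin N → Fin N → Matrix (Fin d) (Fin d) ℝ) (x : Fin N → Fin d → ℝ) :
    (∀ i, (1 + ∑ j ∈ univ.erase i, w i j) *ᵥ x i
            = z i + ∑ j ∈ univ.erase i, (w i j) *ᵥ x j) ↔ statOp w x = z := by
  rw [funext_iff]
  refine forall_congr' fun i => ?_
  have : statOp w x i = (1 + ∑ j ∈ univ.erase i, w i j) *ᵥ x i
      - ∑ j ∈ univ.erase i, (w i j) *ᵥ x j := by
    change x i + ∑ j, w i j *ᵥ (x i - x j) = _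
    rw [← sum_erase (a := i) univ (by simp), add_mulVec, one_mulVec, sum_mulVec]
    simp only [mulVec_sub, sum_sub_distrib]
    abel
  rw [this, sub_eq_iff_eq_add]

/-- `E` attains a unique global minimizer, which is characterized by the stationarity
equations `(I + Σ_{j≠i} w_{ij}) x*_i = z_i + Σ_{j≠i} w_{ij} x*_j`; moreover each matrix
`I + Σ_{j≠i} w_{ij}` is positive definite, and the minimizer satisfies
`x*_i = (I + Σ_{j≠i} w_{ij})⁻¹ (z_i + Σ_{j≠i} w_{ij} x*_j)` (Eqs. (7)–(8)). -/
theorem stmt_3 {N d : ℕ} (hN : 0 < N) (hd : 0 < d)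
    (z : Fin N → Fin d → ℝ)
    (w : Fin N → Fin N → Matrix (Fin d) (Fin d) ℝ)
    (hpsd : ∀ i j, i ≠ j → (w i j).PosSemidef)
    (hsymm : ∀ i j, w i j = w j i) :
    (∀ i : Fin N, (1 + ∑ j ∈ univ.erase i, w i j).PosDef) ∧
    (∃! xs : Fin N → Fin d → ℝ, ∀ y, energy z w xs ≤ energy z w y) ∧
    (∀ xs : Fin N → Fin d → ℝ,
      (∀ y, energy z w xs ≤ energy z w y) ↔
        (∀ i, (1 + ∑ j ∈ univ.erase i, w i j) *ᵥ xs i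
            = z i + ∑ j ∈ univ.erase i, (w i j) *ᵥ xs j)) ∧
    (∀ xs : Fin N → Fin d → ℝ,
      (∀ y, energy z w xs ≤ energy z w y) →
        ∀ i, xs i = (1 + ∑ j ∈ univ.erase i, w i j)⁻¹ *ᵥ
            (z i + ∑ j ∈ univ.erase i, (w i j) *ᵥ xs j)) := by
  have hpd : ∀ i : Fin N, (1 + ∑ j ∈ univ.erase i, w i j).PosDef := fun i =>
    PosDef.one.add_posSemidef
      (posSemidef_sum _ fun j hj => hpsd i j (ne_of_mem_erase hj).symm)
  have hinj : Function.Injective (statOp w) := by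
    rw [injective_iff_map_eq_zero]
    intro h hh
    refine eq_zero_of_energy w hpsd h ?_
    rw [energy_zero_eq w hsymm, hh]
    simp
  obtain ⟨x0, hx0⟩ := LinearMap.injective_iff_surjective.mp hinj z
  have key : ∀ y, energy z w y = energy z w x0 + energy 0 w (y - x0) := by
    intro y
    have := energy_add z w hpsd hsymm x0 (y - x0)
    simpa [hx0] using this
  have hmin : ∀ y, energy z w x0 ≤ energy z w y := fun y => by
    have := energy_zero_nonneg w hpsd (y - x0)
    linarith [key y]
  have huniq : ∀ y, (∀ y', energy z w y ≤ energy z w y') → y = x0 := fun y hy =>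
    sub_eq_zero.mp (eq_zero_of_energy w hpsd _ (by linarith [key y, hy x0]))
  have hiff : ∀ xs : Fin N → Fin d → ℝ,
      (∀ y, energy z w xs ≤ energy z w y) ↔
        (∀ i, (1 + ∑ j ∈ univ.erase i, w i j) *ᵥ xs i
            = z i + ∑ j ∈ univ.erase i, (w i j) *ᵥ xs j) := by
    intro xs
    rw [statOp_iff]
    constructor
    · intro h
      rw [huniq xs h, hx0]
    · intro h
      rw [hinj (h.trans hx0.symm)]
      exact hmin
  refine ⟨hpd, ⟨x0, hmin, huniq⟩, hiff, fun xs hxs i => ?_⟩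
  rw [← (hiff xs).mp hxs i, mulVec_mulVec, nonsing_inv_mul _ ((isUnit_iff_isUnit_det _).mp (hpd i).isUnit),
    one_mulVec]
end

section
/- Let x ∈ (ℝ^d)^N, fix an index i, and let x' ∈ (ℝ^d)^N agree with x in all coordinates except that x'_i = (I + Σ_{j≠i} w_{ij})⁻¹ (z_i + Σ_{j≠i} w_{ij} x_j). Then E(x') ≤ E(x), with equality if and only if x_i already equals x'_i; i.e., each exact coordinate update of Algorithm 1 does not increase the energy, and strictly decreases it unless coordinate i is already optimal. -/
open Matrix Finset

/-- The coordinate-descent update `(I + Σ_{j≠i} w_{ij})⁻¹ (z_i + Σ_{j≠i} w_{ij} x_j)`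
(Eq. (8) of the paper). -/
noncomputable def coordUpdate {N d : ℕ} (z : Fin N → Fin d → ℝ)
    (w : Fin N → Fin N → Matrix (Fin d) (Fin d) ℝ)
    (i : Fin N) (x : Fin N → Fin d → ℝ) : Fin d → ℝ :=
  (1 + ∑ j ∈ univ.erase i, w i j)⁻¹ *ᵥ (z i + ∑ j ∈ univ.erase i, (w i j) *ᵥ x j)

lemma energy_split {N d : ℕ} (z : Fin N → Fin d → ℝ)
    (w : Fin N → Fin N → Matrix (Fin d) (Fin d) ℝ)
    (hsymm : ∀ i j, w i j = w j i) (y : Fin N → Fin d → ℝ) (i : Fin N) :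
    energy z w y = (y i - z i) ⬝ᵥ (y i - z i)
      + ∑ j ∈ univ.erase i, (y i - y j) ⬝ᵥ (w i j) *ᵥ (y i - y j)
      + (∑ k ∈ univ.erase i, (y k - z k) ⬝ᵥ (y k - z k)
        + (1 / 2 : ℝ) * ∑ k ∈ univ.erase i, ∑ j ∈ (univ.erase k).erase i,
            (y k - y j) ⬝ᵥ (w k j) *ᵥ (y k - y j)) := by
  unfold energy
  rw [← Finset.add_sum_erase univ _ (mem_univ i)]
  rw [← Finset.add_sum_erase univ
    (fun k => ∑ j ∈ univ.erase k, (y k - y j) ⬝ᵥ (w k j) *ᵥ (y k - y j)) (mem_univ i)]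
  have h : ∑ k ∈ univ.erase i, ∑ j ∈ univ.erase k, (y k - y j) ⬝ᵥ (w k j) *ᵥ (y k - y j)
      = ∑ k ∈ univ.erase i, (y i - y k) ⬝ᵥ (w i k) *ᵥ (y i - y k)
      + ∑ k ∈ univ.erase i, ∑ j ∈ (univ.erase k).erase i,
            (y k - y j) ⬝ᵥ (w k j) *ᵥ (y k - y j) := by
    rw [← Finset.sum_add_distrib]
    refine Finset.sum_congr rfl fun k hk => ?_
    have hik : i ∈ univ.erase k := by
      simp only [mem_erase, mem_univ, and_true] at hk ⊢
      exact fun h => hk h.symm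
    rw [← Finset.add_sum_erase _ _ hik, hsymm k i, ← neg_sub (y i) (y k), mulVec_neg,
      neg_dotProduct_neg]
  rw [h]
  ring

lemma quad_expand {d : ℕ} (W : Matrix (Fin d) (Fin d) ℝ) (hW : Wᵀ = W) (u v c : Fin d → ℝ) :
    (u - c) ⬝ᵥ W *ᵥ (u - c) = (v - c) ⬝ᵥ W *ᵥ (v - c) + 2 * ((u - v) ⬝ᵥ W *ᵥ (v - c))
      + (u - v) ⬝ᵥ W *ᵥ (u - v) := by
  have e : u - c = (u - v) + (v - c) := by abel
  have hs : (v - c) ⬝ᵥ W *ᵥ (u - v) = (u - v) ⬝ᵥ W *ᵥ (v - c) := by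
    rw [dotProduct_mulVec, ← mulVec_transpose, hW, dotProduct_comm]
  rw [e, mulVec_add, dotProduct_add, add_dotProduct, add_dotProduct, hs]
  ring

lemma energy_diff {N d : ℕ} (z : Fin N → Fin d → ℝ)
    (w : Fin N → Fin N → Matrix (Fin d) (Fin d) ℝ)
    (hpsd : ∀ i j, i ≠ j → (w i j).PosSemidef)
    (hsymm : ∀ i j, w i j = w j i)
    (x : Fin N → Fin d → ℝ) (i : Fin N) (v : Fin d → ℝ) (hv : v = coordUpdate z w i x) :
    energy z w x = energy z w (Function.update x i v) + (x i - v) ⬝ᵥ (x i - v)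
      + ∑ j ∈ univ.erase i, (x i - v) ⬝ᵥ (w i j) *ᵥ (x i - v) := by
  have hA : (1 + ∑ j ∈ univ.erase i, w i j).PosDef := by
    refine Matrix.PosDef.add_posSemidef Matrix.PosDef.one ?_
    refine Matrix.posSemidef_sum _ fun j hj => hpsd i j ?_
    exact (ne_of_mem_erase hj).symm
  have hAv : (1 + ∑ j ∈ univ.erase i, w i j) *ᵥ v
      = z i + ∑ j ∈ univ.erase i, (w i j) *ᵥ x j := by
    rw [hv, coordUpdate, mulVec_mulVec, Matrix.mul_nonsing_inv _
      ((Matrix.isUnit_iff_isUnit_det _).1 hA.isUnit), one_mulVec]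
  have hgrad : (v - z i) + ∑ j ∈ univ.erase i, (w i j) *ᵥ (v - x j) = 0 := by
    rw [add_mulVec, one_mulVec, sum_mulVec] at hAv
    simp only [mulVec_sub, Finset.sum_sub_distrib]
    rw [sub_add_sub_comm, hAv, sub_self]
  have hg2 : (x i - v) ⬝ᵥ (v - z i)
      + ∑ j ∈ univ.erase i, (x i - v) ⬝ᵥ (w i j) *ᵥ (v - x j) = 0 := by
    rw [← dotProduct_sum, ← dotProduct_add, hgrad, dotProduct_zero]
  rw [energy_split z w hsymm x i, energy_split z w hsymm (Function.update x i v) i]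
  have h1 : ∑ k ∈ univ.erase i, (Function.update x i v k - z k) ⬝ᵥ (Function.update x i v k - z k)
      = ∑ k ∈ univ.erase i, (x k - z k) ⬝ᵥ (x k - z k) :=
    Finset.sum_congr rfl fun k hk => by rw [Function.update_of_ne (ne_of_mem_erase hk)]
  have h2 : ∑ k ∈ univ.erase i, ∑ j ∈ (univ.erase k).erase i,
        (Function.update x i v k - Function.update x i v j) ⬝ᵥ (w k j) *ᵥ
          (Function.update x i v k - Function.update x i v j)
      = ∑ k ∈ univ.erase i, ∑ j ∈ (univ.erase k).erase i,
        (x k - x j) ⬝ᵥ (w k j) *ᵥ (x k - x j) :=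
    Finset.sum_congr rfl fun k hk => Finset.sum_congr rfl fun j hj => by
      rw [Function.update_of_ne (ne_of_mem_erase hk), Function.update_of_ne (ne_of_mem_erase hj)]
  have h3 : ∑ j ∈ univ.erase i, (Function.update x i v i - Function.update x i v j) ⬝ᵥ (w i j) *ᵥ
          (Function.update x i v i - Function.update x i v j)
      = ∑ j ∈ univ.erase i, (v - x j) ⬝ᵥ (w i j) *ᵥ (v - x j) :=
    Finset.sum_congr rfl fun j hj => by
      rw [Function.update_of_ne (ne_of_mem_erase hj), Function.update_self]
  have h4 : ∑ j ∈ univ.erase i, (x i - x j) ⬝ᵥ (w i j) *ᵥ (x i - x j)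
      = ∑ j ∈ univ.erase i, (v - x j) ⬝ᵥ (w i j) *ᵥ (v - x j)
        + 2 * ∑ j ∈ univ.erase i, (x i - v) ⬝ᵥ (w i j) *ᵥ (v - x j)
        + ∑ j ∈ univ.erase i, (x i - v) ⬝ᵥ (w i j) *ᵥ (x i - v) := by
    rw [Finset.mul_sum, ← Finset.sum_add_distrib, ← Finset.sum_add_distrib]
    refine Finset.sum_congr rfl fun j hj => quad_expand _ ?_ _ _ _
    have := (hpsd i j (ne_of_mem_erase hj).symm).isHermitian
    rwa [Matrix.IsHermitian, conjTranspose_eq_transpose_of_trivial] at this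
  have h5 := quad_expand (1 : Matrix (Fin d) (Fin d) ℝ) transpose_one (x i) v (z i)
  simp only [one_mulVec] at h5
  rw [h1, h2, h3, h4, h5, Function.update_self]
  linarith

/-- Each exact coordinate update of Algorithm 1 does not increase the energy, and
strictly decreases it unless coordinate `i` is already optimal: if `x'` agrees with
`x` except that `x'_i = (I + Σ_{j≠i} w_{ij})⁻¹ (z_i + Σ_{j≠i} w_{ij} x_j)`, then
`E(x') ≤ E(x)`, with equality iff `x_i = x'_i`. -/
theorem stmt_7 {N d : ℕ} (hN : 0 < N) (hd : 0 < d)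
    (z : Fin N → Fin d → ℝ)
    (w : Fin N → Fin N → Matrix (Fin d) (Fin d) ℝ)
    (hpsd : ∀ i j, i ≠ j → (w i j).PosSemidef)
    (hsymm : ∀ i j, w i j = w j i)
    (x : Fin N → Fin d → ℝ) (i : Fin N)
    (x' : Fin N → Fin d → ℝ)
    (hx' : x' = Function.update x i (coordUpdate z w i x)) :
    energy z w x' ≤ energy z w x ∧
    (energy z w x' = energy z w x ↔ x i = x' i) := by
  have hd := energy_diff z w hpsd hsymm x i _ rfl
  rw [← hx'] at hd
  have hxi : x' i = coordUpdate z w i x := by rw [hx', Function.update_self]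
  rw [← hxi] at hd
  have hS : 0 ≤ ∑ j ∈ univ.erase i, (x i - x' i) ⬝ᵥ (w i j) *ᵥ (x i - x' i) :=
    Finset.sum_nonneg fun j hj => by
      have := (hpsd i j (ne_of_mem_erase hj).symm).dotProduct_mulVec_nonneg (x i - x' i)
      simpa using this
  have hD : 0 ≤ (x i - x' i) ⬝ᵥ (x i - x' i) :=
    Finset.sum_nonneg fun k _ => mul_self_nonneg _
  refine ⟨by linarith, fun h => ?_, fun h => ?_⟩
  · have h0 : (x i - x' i) ⬝ᵥ (x i - x' i) = 0 := by linarith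
    exact sub_eq_zero.1 (dotProduct_self_eq_zero.1 h0)
  · rw [h, sub_self] at hd
    simp at hd
    exact hd.symm
end

section
/- Let V be a finite index set, L a finite label set, and E : L^V → ℝ an arbitrary energy function; let P(x) = exp(−E(x))/Z with Z = Σ_{x∈L^V} exp(−E(x)). Fix i ∈ V and probability mass functions q_j on L for every j ≠ i, and for l ∈ L set m(l) = Σ_{x ∈ L^V with x_i = l} (Π_{j≠i} q_j(x_j)) · E(x) (the expectation of E given x_i = l under the product of the other factors). Then, over all probability mass functions q_i on L, the Kullback–Leibler divergence KL(Π_{j∈V} q_j ‖ P) = Σ_{x∈L^V} (Π_j q_j(x_j)) log( (Π_j q_j(x_j)) / P(x) ) is uniquely minimized at q*_i(l) = exp(−m(l)) / Σ_{l'∈L} exp(−m(l')) (the general mean-field update of one factor of a discrete CRF). -/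
open Finset

/-- The Gibbs distribution `P(x) = exp(−E(x)) / Σ_y exp(−E(y))` on `L^V`. -/
noncomputable def gibbsP {V L : Type*} [Fintype V] [DecidableEq V] [Fintype L]
    (E : (V → L) → ℝ) (x : V → L) : ℝ :=
  Real.exp (-E x) / ∑ y : V → L, Real.exp (-E y)

/-- The Kullback–Leibler divergence `KL(Π_j q_j ‖ P)` of the fully factorized
distribution `Q(x) = Π_j q_j(x_j)` from the Gibbs distribution of `E` (with the
convention `0·log 0 = 0`, which holds in Lean since `log 0 = 0`). -/
noncomputable def klProd {V L : Type*} [Fintype V] [DecidableEq V] [Fintype L]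
    (E : (V → L) → ℝ) (q : V → L → ℝ) : ℝ :=
  ∑ x : V → L, (∏ j, q j (x j)) * Real.log ((∏ j, q j (x j)) / gibbsP E x)

/-- `m(l) = Σ_{x : x_i = l} (Π_{j≠i} q_j(x_j)) E(x)`, the expectation of `E` given
`x_i = l` under the product of the factors other than `i`. -/
noncomputable def condEnergy {V L : Type*} [Fintype V] [DecidableEq V]
    [Fintype L] [DecidableEq L]
    (E : (V → L) → ℝ) (q : V → L → ℝ) (i : V) (l : L) : ℝ :=
  ∑ x : V → L, if x i = l then (∏ j ∈ univ.erase i, q j (x j)) * E x else 0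

/-- The general mean-field update of one factor: `q*_i(l) ∝ exp(−m(l))`. -/
noncomputable def mfUpdate {V L : Type*} [Fintype V] [DecidableEq V]
    [Fintype L] [DecidableEq L]
    (E : (V → L) → ℝ) (q : V → L → ℝ) (i : V) (l : L) : ℝ :=
  Real.exp (-condEnergy E q i l) / ∑ l' : L, Real.exp (-condEnergy E q i l')

theorem aux_R {V L : Type*} [Fintype V] [DecidableEq V] [Fintype L] [DecidableEq L]
    (i : V) (q : V → L → ℝ) (hq1 : ∀ j, j ≠ i → ∑ l, q j l = 1) (l : L) :
    (∑ x : V → L, if x i = l then (∏ j ∈ univ.erase i, q j (x j)) else 0) = 1 := by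
  have h : ∀ x : V → L, (if x i = l then (∏ j ∈ univ.erase i, q j (x j)) else 0) =
      ∏ j, (Function.update q i (fun k => if k = l then 1 else 0)) j (x j) := by
    intro x
    rw [← Finset.mul_prod_erase univ _ (Finset.mem_univ i)]
    have : ∏ j ∈ univ.erase i, (Function.update q i (fun k => if k = l then 1 else 0)) j (x j)
        = ∏ j ∈ univ.erase i, q j (x j) := by
      refine Finset.prod_congr rfl fun j hj => ?_
      rw [Function.update_of_ne (Finset.ne_of_mem_erase hj)]
    rw [this]
    simp
  simp_rw [h]
  rw [← Fintype.prod_sum]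
  refine Finset.prod_eq_one fun j _ => ?_
  by_cases hj : j = i
  · subst hj
    simp
  · rw [Function.update_of_ne hj]
    exact hq1 j hj

theorem aux_swap {V L : Type*} [Fintype V] [DecidableEq V] [Fintype L] [DecidableEq L]
    (i : V) (q : V → L → ℝ) (g : ℝ → ℝ) (l l' : L) :
    (∑ x : V → L, if x i = l then g (∏ j ∈ univ.erase i, q j (x j)) else 0) =
    (∑ x : V → L, if x i = l' then g (∏ j ∈ univ.erase i, q j (x j)) else 0) := by
  rw [← Equiv.sum_comp (Equiv.piCongrRight
    (fun j : V => if j = i then Equiv.swap l l' else Equiv.refl L))]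
  refine Finset.sum_congr rfl fun x _ => ?_
  have h1 : ∏ j ∈ univ.erase i, q j ((Equiv.piCongrRight
    (fun j : V => if j = i then Equiv.swap l l' else Equiv.refl L)) x j) =
      ∏ j ∈ univ.erase i, q j (x j) := by
    refine Finset.prod_congr rfl fun j hj => ?_
    simp [Finset.ne_of_mem_erase hj]
  rw [h1]
  have h2 : (Equiv.piCongrRight
    (fun j : V => if j = i then Equiv.swap l l' else Equiv.refl L)) x i = l ↔ x i = l' := by
    simp [Equiv.swap_apply_eq_iff]
  simp only [h2]

theorem aux_fiber {V L : Type*} [Fintype V] [DecidableEq V] [Fintype L] [DecidableEq L]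
    (i : V) (f : L → ℝ) (g : (V → L) → ℝ) :
    ∑ x : V → L, f (x i) * g x = ∑ l, f l * ∑ x : V → L, if x i = l then g x else 0 := by
  simp_rw [Finset.mul_sum]
  rw [Finset.sum_comm]
  refine Finset.sum_congr rfl fun x _ => ?_
  simp

theorem aux_kl {V L : Type*} [Fintype V] [DecidableEq V]
    [Fintype L] [DecidableEq L] [Nonempty L]
    (E : (V → L) → ℝ) (i : V) (q : V → L → ℝ)
    (hq1 : ∀ j, j ≠ i → ∑ l, q j l = 1) :
    ∃ C : ℝ, ∀ p : L → ℝ, ∑ l, p l = 1 →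
      klProd E (Function.update q i p) =
        ∑ l, p l * Real.log (p l) + ∑ l, p l * condEnergy E q i l + C := by
  obtain ⟨l0⟩ := ‹Nonempty L›
  set Z := ∑ y : V → L, Real.exp (-E y) with hZ
  have hZpos : 0 < Z := Finset.sum_pos (fun y _ => Real.exp_pos _) ⟨fun _ => l0, Finset.mem_univ _⟩
  set C := ∑ x : V → L, if x i = l0 then
    (fun r : ℝ => r * Real.log r) (∏ j ∈ univ.erase i, q j (x j)) else 0 with hC
  refine ⟨C + Real.log Z, fun p hp => ?_⟩
  have hprod : ∀ x : V → L, ∏ j, (Function.update q i p) j (x j) =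
      p (x i) * ∏ j ∈ univ.erase i, q j (x j) := by
    intro x
    rw [← Finset.mul_prod_erase univ _ (Finset.mem_univ i)]
    congr 1
    · simp
    · refine Finset.prod_congr rfl fun j hj => ?_
      rw [Function.update_of_ne (Finset.ne_of_mem_erase hj)]
  have hterm : ∀ x : V → L, (∏ j, (Function.update q i p) j (x j)) *
      Real.log ((∏ j, (Function.update q i p) j (x j)) / gibbsP E x) =
      (p (x i) * Real.log (p (x i))) * (∏ j ∈ univ.erase i, q j (x j)) +
      p (x i) * ((fun r : ℝ => r * Real.log r) (∏ j ∈ univ.erase i, q j (x j))) +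
      p (x i) * ((∏ j ∈ univ.erase i, q j (x j)) * E x) +
      (p (x i) * Real.log Z) * (∏ j ∈ univ.erase i, q j (x j)) := by
    intro x
    rw [hprod]
    generalize (∏ j ∈ univ.erase i, q j (x j)) = R
    by_cases h1 : p (x i) = 0
    · simp [h1]
    by_cases h2 : R = 0
    · simp [h2]
    have : gibbsP E x = Real.exp (-E x) / Z := rfl
    rw [this, Real.log_div (mul_ne_zero h1 h2) (div_pos (Real.exp_pos _) hZpos).ne',
      Real.log_mul h1 h2, Real.log_div (Real.exp_pos _).ne' hZpos.ne', Real.log_exp]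
    ring
  unfold klProd
  rw [Finset.sum_congr rfl fun x _ => hterm x]
  rw [Finset.sum_add_distrib, Finset.sum_add_distrib, Finset.sum_add_distrib]
  rw [aux_fiber i (fun l => p l * Real.log (p l)) (fun x => ∏ j ∈ univ.erase i, q j (x j)),
    aux_fiber i p (fun x => (fun r : ℝ => r * Real.log r) (∏ j ∈ univ.erase i, q j (x j))),
    aux_fiber i p (fun x => (∏ j ∈ univ.erase i, q j (x j)) * E x),
    aux_fiber i (fun l => p l * Real.log Z) (fun x => ∏ j ∈ univ.erase i, q j (x j))]
  simp_rw [aux_R i q hq1]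
  rw [Finset.sum_congr rfl fun l _ => congrArg (fun t => p l * t)
    (aux_swap i q (fun r : ℝ => r * Real.log r) l l0)]
  rw [← hC]
  simp only [mul_one]
  rw [← Finset.sum_mul, ← Finset.sum_mul, hp]
  unfold condEnergy
  ring

theorem aux_gibbs (p s : ℝ) (hp : 0 ≤ p) (hs : 0 < s) :
    p - s ≤ p * (Real.log p - Real.log s) ∧
      (p ≠ s → p - s < p * (Real.log p - Real.log s)) := by
  have key : p ≠ s → p - s < p * (Real.log p - Real.log s) := by
    intro hne
    rcases hp.eq_or_lt with h | h
    · rw [← h]; simp [hs]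
    · have h3 : s / p ≠ 1 := by
        intro h4
        rw [div_eq_one_iff_eq h.ne'] at h4
        exact hne h4.symm
      have h5 := Real.log_lt_sub_one_of_pos (div_pos hs h) h3
      rw [Real.log_div hs.ne' h.ne'] at h5
      have h6 := mul_lt_mul_of_pos_left h5 h
      have h7 : p * (s / p - 1) = s - p := by field_simp
      linarith
  refine ⟨?_, key⟩
  by_cases h : p = s
  · simp [h]
  · exact (key h).le

/-- Fixing probability mass functions `q_j` for `j ≠ i`, over all probability mass
functions `q_i` on `L` the KL divergence `KL(Π_j q_j ‖ P)` is uniquely minimized at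
`q*_i(l) = exp(−m(l)) / Σ_{l'} exp(−m(l'))` (the general mean-field update of one
factor of a discrete CRF); moreover `q*_i` is itself a probability mass function. -/
theorem stmt_15 {V L : Type*} [Fintype V] [DecidableEq V]
    [Fintype L] [DecidableEq L] [Nonempty L]
    (E : (V → L) → ℝ) (i : V) (q : V → L → ℝ)
    (hq0 : ∀ j, j ≠ i → ∀ l, 0 ≤ q j l)
    (hq1 : ∀ j, j ≠ i → ∑ l, q j l = 1) :
    (∀ l, 0 ≤ mfUpdate E q i l) ∧ (∑ l, mfUpdate E q i l = 1) ∧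
    (∀ qi : L → ℝ, (∀ l, 0 ≤ qi l) → (∑ l, qi l = 1) → qi ≠ mfUpdate E q i →
      klProd E (Function.update q i (mfUpdate E q i)) <
        klProd E (Function.update q i qi)) := by
  set W := ∑ l' : L, Real.exp (-condEnergy E q i l') with hW
  have hWpos : 0 < W := Finset.sum_pos (fun y _ => Real.exp_pos _) Finset.univ_nonempty
  have hdef : ∀ l, mfUpdate E q i l = Real.exp (-condEnergy E q i l) / W := fun l => rfl
  have hpos : ∀ l, 0 < mfUpdate E q i l := fun l => by
    rw [hdef]; exact div_pos (Real.exp_pos _) hWpos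
  have hsum : ∑ l, mfUpdate E q i l = 1 := by
    simp_rw [hdef]
    rw [← Finset.sum_div, ← hW, div_self hWpos.ne']
  refine ⟨fun l => (hpos l).le, hsum, fun p hp0 hp1 hne => ?_⟩
  obtain ⟨C, hC⟩ := aux_kl E i q hq1
  have hm : ∀ l, condEnergy E q i l = - Real.log (mfUpdate E q i l) - Real.log W := by
    intro l
    rw [hdef, Real.log_div (Real.exp_pos _).ne' hWpos.ne', Real.log_exp]
    ring
  have hform : ∀ r : L → ℝ, ∑ l, r l = 1 → klProd E (Function.update q i r) =
      ∑ l, r l * (Real.log (r l) - Real.log (mfUpdate E q i l)) + (C - Real.log W) := by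
    intro r hr
    rw [hC r hr, ← Finset.sum_add_distrib]
    have : ∀ l, r l * Real.log (r l) + r l * condEnergy E q i l =
        r l * (Real.log (r l) - Real.log (mfUpdate E q i l)) - r l * Real.log W := by
      intro l
      rw [hm l]
      ring
    simp_rw [this]
    rw [Finset.sum_sub_distrib, ← Finset.sum_mul, hr]
    ring
  rw [hform _ hsum, hform p hp1]
  simp only [sub_self, mul_zero, Finset.sum_const_zero]
  obtain ⟨l, hl⟩ := Function.ne_iff.mp hne
  have : ∑ l, (p l - mfUpdate E q i l) <
      ∑ l, p l * (Real.log (p l) - Real.log (mfUpdate E q i l)) :=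
    Finset.sum_lt_sum (fun l _ => (aux_gibbs _ _ (hp0 l) (hpos l)).1)
      ⟨l, Finset.mem_univ _, (aux_gibbs _ _ (hp0 l) (hpos l)).2 hl⟩
  rw [Finset.sum_sub_distrib, hp1, hsum] at this
  linarith
end

section
/- Fix i ∈ V and probability mass functions q_j on L for every j ≠ i. Then, over all probability mass functions q_i on L, KL(Q‖P) is uniquely minimized at Q*_i(l) = (1/Z_i) exp( −ψ_u(i, l) − Σ_{l'∈L} μ(l, l') Σ_{j∈N(i)} K_{ij} q_j(l') ), where Z_i = Σ_{l∈L} exp( −ψ_u(i, l) − Σ_{l'∈L} μ(l, l') Σ_{j∈N(i)} K_{ij} q_j(l') ) is the normalizing constant (the mean-field update of the pairwise discrete CRF, Eq. (28) of the paper). -/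
open Finset

/-- The pairwise discrete CRF energy
`E(x) = Σ_i ψ_u(i, x_i) + Σ_{{i,j}∈E} μ(x_i, x_j) K_{ij}`, each unordered edge of the
graph `G` counted once (written as half the symmetric double sum, which agrees with
the sum over unordered edges since `μ` and `K` are symmetric). -/
noncomputable def crfEnergy {V L : Type*} [Fintype V]
    (G : SimpleGraph V) [DecidableRel G.Adj]
    (ψ : V → L → ℝ) (μc : L → L → ℝ) (K : V → V → ℝ) (x : V → L) : ℝ :=
  ∑ i, ψ i (x i) +
    (1 / 2 : ℝ) * ∑ i, ∑ j, if G.Adj i j then μc (x i) (x j) * K i j else 0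

/-- The mean-field update of the pairwise discrete CRF (Eq. (28) of the paper):
`Q*_i(l) ∝ exp(−ψ_u(i,l) − Σ_{l'} μ(l,l') Σ_{j∈N(i)} K_{ij} q_j(l'))`. -/
noncomputable def crfMfUpdate {V L : Type*} [Fintype V]
    (G : SimpleGraph V) [DecidableRel G.Adj]
    (ψ : V → L → ℝ) (μc : L → L → ℝ) (K : V → V → ℝ) [Fintype L]
    (q : V → L → ℝ) (i : V) (l : L) : ℝ :=
  Real.exp (-ψ i l - ∑ l', μc l l' * ∑ j, if G.Adj i j then K i j * q j l' else 0) /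
    ∑ m : L, Real.exp
      (-ψ i m - ∑ l', μc m l' * ∑ j, if G.Adj i j then K i j * q j l' else 0)

section helpers

variable {V L : Type*} [Fintype V] [DecidableEq V] [Fintype L] [DecidableEq L]

lemma aux_prodsum (w : V → L → ℝ) :
    ∑ x : V → L, ∏ j, w j (x j) = ∏ j, ∑ l, w j l := by
  rw [Finset.prod_univ_sum, Fintype.piFinset_univ]

lemma aux_m1 (p : V → L → ℝ) (hp : ∀ j, ∑ l, p j l = 1) (k : V) (f : L → ℝ) :
    ∑ x : V → L, (∏ j, p j (x j)) * f (x k) = ∑ l, p k l * f l := by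
  have h := aux_prodsum (fun j l => p j l * (if j = k then f l else 1))
  have h1 : ∀ x : V → L, (∏ j, p j (x j) * (if j = k then f (x j) else 1))
      = (∏ j, p j (x j)) * f (x k) := by
    intro x
    rw [Finset.prod_mul_distrib]
    simp
  simp only [h1] at h
  rw [h, Finset.prod_eq_single k]
  · simp
  · intro b _ hb
    simp [hb, hp]
  · simp

lemma aux_m2' (p : V → L → ℝ) (hp : ∀ j, ∑ l, p j l = 1) (a b : V) (hab : a ≠ b)
    (f g : L → ℝ) :
    ∑ x : V → L, (∏ j, p j (x j)) * (f (x a) * g (x b))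
      = (∑ l, p a l * f l) * ∑ l, p b l * g l := by
  have h := aux_prodsum (fun j l => p j l *
    ((if j = a then f l else 1) * (if j = b then g l else 1)))
  have h1 : ∀ x : V → L, (∏ j, p j (x j) *
      ((if j = a then f (x j) else 1) * (if j = b then g (x j) else 1)))
      = (∏ j, p j (x j)) * (f (x a) * g (x b)) := by
    intro x
    rw [Finset.prod_mul_distrib, Finset.prod_mul_distrib]
    simp
  simp only [h1] at h
  rw [h, Finset.prod_eq_mul a b hab]
  · simp [hab, hab.symm]
  · intro c _ hc
    simp [hc.1, hc.2, hp]
  · simp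
  · simp

lemma aux_m2 (p : V → L → ℝ) (hp : ∀ j, ∑ l, p j l = 1) (a b : V) (hab : a ≠ b)
    (m : L → L → ℝ) :
    ∑ x : V → L, (∏ j, p j (x j)) * m (x a) (x b)
      = ∑ l, ∑ l', p a l * p b l' * m l l' := by
  have h1 : ∀ x : V → L, (∏ j, p j (x j)) * m (x a) (x b)
      = ∑ l, (∏ j, p j (x j)) * ((if x a = l then 1 else 0) * m l (x b)) := by
    intro x
    simp
  simp only [h1]
  rw [Finset.sum_comm]
  refine Finset.sum_congr rfl fun l _ => ?_
  rw [aux_m2' p hp a b hab (fun y => if y = l then 1 else 0) (fun y => m l y)]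
  simp [Finset.mul_sum, mul_assoc]

lemma aux_kl_s16 [Nonempty L] (E : (V → L) → ℝ) (p : V → L → ℝ) (hp : ∀ j, ∑ l, p j l = 1) :
    klProd E p = (∑ j, ∑ l, p j l * Real.log (p j l))
      + (∑ x : V → L, (∏ j, p j (x j)) * E x)
      + Real.log (∑ y : V → L, Real.exp (-E y)) := by
  have hZ : 0 < ∑ y : V → L, Real.exp (-E y) :=
    Finset.sum_pos (fun _ _ => Real.exp_pos _) Finset.univ_nonempty
  have h1 : ∀ x : V → L, (∏ j, p j (x j)) * Real.log ((∏ j, p j (x j)) / gibbsP E x)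
      = (∑ k, (∏ j, p j (x j)) * Real.log (p k (x k))) + (∏ j, p j (x j)) * E x
        + (∏ j, p j (x j)) * Real.log (∑ y : V → L, Real.exp (-E y)) := by
    intro x
    by_cases h : (∏ j, p j (x j)) = 0
    · simp [h]
    · have h' : ∀ j ∈ Finset.univ, p j (x j) ≠ 0 := Finset.prod_ne_zero_iff.1 h
      have hg : gibbsP E x ≠ 0 := (div_pos (Real.exp_pos _) hZ).ne'
      rw [Real.log_div h hg, gibbsP, Real.log_div (Real.exp_pos _).ne' hZ.ne', Real.log_exp,
        Real.log_prod h', ← Finset.mul_sum]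
      ring
  have h2 : ∑ x : V → L, ∏ j, p j (x j) = 1 := by
    rw [aux_prodsum]; simp [hp]
  unfold klProd
  simp only [h1, Finset.sum_add_distrib]
  rw [← Finset.sum_mul, h2, one_mul, Finset.sum_comm]
  congr 2
  exact Finset.sum_congr rfl fun k _ => aux_m1 p hp k (fun l => Real.log (p k l))

lemma aux_energy (G : SimpleGraph V) [DecidableRel G.Adj]
    (ψ : V → L → ℝ) (μc : L → L → ℝ) (K : V → V → ℝ)
    (p : V → L → ℝ) (hp : ∀ j, ∑ l, p j l = 1) :
    ∑ x : V → L, (∏ j, p j (x j)) * crfEnergy G ψ μc K x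
      = (∑ j, ∑ l, p j l * ψ j l) + (1 / 2 : ℝ) * ∑ j, ∑ k,
        if G.Adj j k then K j k * ∑ l, ∑ l', p j l * p k l' * μc l l' else 0 := by
  have h1 : ∀ x : V → L, (∏ j, p j (x j)) * crfEnergy G ψ μc K x
      = (∑ k, (∏ j, p j (x j)) * ψ k (x k)) + (1 / 2 : ℝ) * ∑ a, ∑ b,
        if G.Adj a b then K a b * ((∏ j, p j (x j)) * μc (x a) (x b)) else 0 := by
    intro x
    unfold crfEnergy
    rw [mul_add, Finset.mul_sum, mul_left_comm, Finset.mul_sum]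
    congr 2
    refine Finset.sum_congr rfl fun a _ => ?_
    rw [Finset.mul_sum]
    refine Finset.sum_congr rfl fun b _ => ?_
    split_ifs
    · ring
    · ring
  simp only [h1, Finset.sum_add_distrib]
  rw [Finset.sum_comm, ← Finset.mul_sum]
  congr 2
  · exact funext fun k => aux_m1 p hp k (ψ k)
  · rw [Finset.sum_comm]
    refine Finset.sum_congr rfl fun a _ => ?_
    rw [Finset.sum_comm]
    refine Finset.sum_congr rfl fun b _ => ?_
    split_ifs with h
    · rw [← Finset.mul_sum, aux_m2 p hp a b h.ne μc]
    · simp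

lemma aux_pair (i : V) (B : V → V → ℝ) (hB : ∀ a b, B a b = B b a) (h0 : B i i = 0) :
    (1 / 2 : ℝ) * ∑ a, ∑ b, B a b = ∑ b, B i b
      + (1 / 2 : ℝ) * ∑ a ∈ univ.erase i, ∑ b ∈ univ.erase i, B a b := by
  have e : ∀ f : V → ℝ, ∑ a, f a = f i + ∑ a ∈ univ.erase i, f a := fun f =>
    (Finset.add_sum_erase _ f (Finset.mem_univ i)).symm
  rw [e (fun a => ∑ b, B a b)]
  have : ∑ a ∈ univ.erase i, ∑ b, B a b
      = ∑ b ∈ univ.erase i, B i b + ∑ a ∈ univ.erase i, ∑ b ∈ univ.erase i, B a b := by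
    rw [← Finset.sum_add_distrib]
    refine Finset.sum_congr rfl fun a _ => ?_
    rw [e (B a), hB a i]
  rw [this, e (B i), h0]
  ring

lemma aux_F [Nonempty L] (G : SimpleGraph V) [DecidableRel G.Adj]
    (ψ : V → L → ℝ) (μc : L → L → ℝ) (hμ : ∀ l l', μc l l' = μc l' l)
    (K : V → V → ℝ) (hK : ∀ i j, K i j = K j i)
    (i : V) (q : V → L → ℝ) (hq1 : ∀ j, j ≠ i → ∑ l, q j l = 1) :
    ∃ C : ℝ, ∀ r : L → ℝ, ∑ l, r l = 1 →
      klProd (crfEnergy G ψ μc K) (Function.update q i r)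
        = ∑ l, (r l * Real.log (r l) - r l *
          (-ψ i l - ∑ l', μc l l' * ∑ j, if G.Adj i j then K i j * q j l' else 0)) + C := by
  refine ⟨(∑ j ∈ univ.erase i, ∑ l, q j l * Real.log (q j l))
    + (∑ j ∈ univ.erase i, ∑ l, q j l * ψ j l)
    + (1 / 2 : ℝ) * (∑ a ∈ univ.erase i, ∑ b ∈ univ.erase i,
        if G.Adj a b then K a b * ∑ l, ∑ l', q a l * q b l' * μc l l' else 0)
    + Real.log (∑ y : V → L, Real.exp (-crfEnergy G ψ μc K y)), fun r hr => ?_⟩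
  have hp : ∀ j, ∑ l, Function.update q i r j l = 1 := by
    intro j
    by_cases h : j = i
    · subst h; simpa using hr
    · simpa [h] using hq1 j h
  rw [aux_kl_s16 _ _ hp, aux_energy _ _ _ _ _ hp]
  rw [aux_pair i]
  · rw [← Finset.add_sum_erase univ _ (Finset.mem_univ i),
      ← Finset.add_sum_erase univ (fun j => ∑ l, Function.update q i r j l * ψ j l)
        (Finset.mem_univ i)]
    have e1 : ∑ j ∈ univ.erase i, ∑ l,
        Function.update q i r j l * Real.log (Function.update q i r j l)
        = ∑ j ∈ univ.erase i, ∑ l, q j l * Real.log (q j l) :=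
      Finset.sum_congr rfl fun j hj => by
        rw [Function.update_of_ne (Finset.ne_of_mem_erase hj)]
    have e2 : ∑ j ∈ univ.erase i, ∑ l, Function.update q i r j l * ψ j l
        = ∑ j ∈ univ.erase i, ∑ l, q j l * ψ j l :=
      Finset.sum_congr rfl fun j hj => by
        rw [Function.update_of_ne (Finset.ne_of_mem_erase hj)]
    have e3 : (∑ a ∈ univ.erase i, ∑ b ∈ univ.erase i,
        if G.Adj a b then K a b * ∑ l, ∑ l',
          Function.update q i r a l * Function.update q i r b l' * μc l l' else 0)
        = ∑ a ∈ univ.erase i, ∑ b ∈ univ.erase i,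
        if G.Adj a b then K a b * ∑ l, ∑ l', q a l * q b l' * μc l l' else 0 :=
      Finset.sum_congr rfl fun j hj => Finset.sum_congr rfl fun k hk => by
        rw [Function.update_of_ne (Finset.ne_of_mem_erase hj),
          Function.update_of_ne (Finset.ne_of_mem_erase hk)]
    have e4 : (∑ b, if G.Adj i b then K i b * ∑ l, ∑ l',
          Function.update q i r i l * Function.update q i r b l' * μc l l' else 0)
        = ∑ l, r l * ∑ l', μc l l' * ∑ j, if G.Adj i j then K i j * q j l' else 0 := by
      simp only [Finset.mul_sum]
      rw [Finset.sum_congr rfl (fun l _ => Finset.sum_comm), Finset.sum_comm]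
      refine Finset.sum_congr rfl fun b _ => ?_
      split_ifs with h
      · rw [Function.update_of_ne h.ne', Function.update_self]
        refine Finset.sum_congr rfl fun l _ => Finset.sum_congr rfl fun l' _ => ?_
        ring
      · simp
    rw [e1, e2, e3, e4]
    simp only [Function.update_self, mul_sub, Finset.sum_sub_distrib, mul_neg,
      Finset.sum_neg_distrib]
    ring
  · intro a b
    simp only [G.adj_comm a b, hK a b]
    split_ifs
    · congr 1
      rw [Finset.sum_comm]
      refine Finset.sum_congr rfl fun l _ => Finset.sum_congr rfl fun l' _ => ?_
      rw [hμ l' l]; ring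
    · rfl
  · simp

lemma aux_gibbs_s16 (a b : ℝ) (ha : 0 ≤ a) (hb : 0 < b) :
    a - b ≤ a * Real.log a - a * Real.log b ∧
    (a ≠ b → a - b < a * Real.log a - a * Real.log b) := by
  have key : a ≠ b → a - b < a * Real.log a - a * Real.log b := by
    intro hne
    rcases ha.eq_or_lt with h | h
    · subst h; simpa using hb
    · have := Real.log_lt_sub_one_of_pos (div_pos hb h)
        (by intro h1; rw [div_eq_one_iff_eq h.ne'] at h1; exact hne h1.symm)
      rw [Real.log_div hb.ne' h.ne'] at this
      have h2 := mul_lt_mul_of_pos_left this h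
      have h3 : a * (b / a - 1) = b - a := by field_simp
      rw [h3] at h2
      linarith
  refine ⟨?_, key⟩
  by_cases h : a = b
  · subst h; simp
  · exact (key h).le

end helpers

/-- Fixing probability mass functions `q_j` for `j ≠ i`, over all probability mass
functions `q_i` on `L` the KL divergence `KL(Q‖P)` for the pairwise discrete CRF is
uniquely minimized at
`Q*_i(l) = (1/Z_i) exp(−ψ_u(i,l) − Σ_{l'} μ(l,l') Σ_{j∈N(i)} K_{ij} q_j(l'))`
(Eq. (28) of the paper); moreover `Q*_i` is itself a probability mass function. -/
theorem stmt_16 {V L : Type*} [Fintype V] [DecidableEq V]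
    [Fintype L] [DecidableEq L] [Nonempty L]
    (G : SimpleGraph V) [DecidableRel G.Adj]
    (ψ : V → L → ℝ) (μc : L → L → ℝ) (hμ : ∀ l l', μc l l' = μc l' l)
    (K : V → V → ℝ) (hK : ∀ i j, K i j = K j i)
    (i : V) (q : V → L → ℝ)
    (hq0 : ∀ j, j ≠ i → ∀ l, 0 ≤ q j l)
    (hq1 : ∀ j, j ≠ i → ∑ l, q j l = 1) :
    (∀ l, 0 ≤ crfMfUpdate G ψ μc K q i l) ∧
    (∑ l, crfMfUpdate G ψ μc K q i l = 1) ∧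
    (∀ qi : L → ℝ, (∀ l, 0 ≤ qi l) → (∑ l, qi l = 1) →
      qi ≠ crfMfUpdate G ψ μc K q i →
      klProd (crfEnergy G ψ μc K) (Function.update q i (crfMfUpdate G ψ μc K q i)) <
        klProd (crfEnergy G ψ μc K) (Function.update q i qi)) := by
  set h : L → ℝ := fun l =>
    -ψ i l - ∑ l', μc l l' * ∑ j, if G.Adj i j then K i j * q j l' else 0 with hh
  have hZ : 0 < ∑ m, Real.exp (h m) :=
    Finset.sum_pos (fun _ _ => Real.exp_pos _) Finset.univ_nonempty
  have hs : ∀ l, crfMfUpdate G ψ μc K q i l = Real.exp (h l) / ∑ m, Real.exp (h m) :=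
    fun l => rfl
  have hpos : ∀ l, 0 < crfMfUpdate G ψ μc K q i l := fun l => by
    rw [hs]; exact div_pos (Real.exp_pos _) hZ
  have hsum : ∑ l, crfMfUpdate G ψ μc K q i l = 1 := by
    simp only [hs]
    rw [← Finset.sum_div, div_self hZ.ne']
  refine ⟨fun l => (hpos l).le, hsum, fun r hr0 hr1 hne => ?_⟩
  obtain ⟨C, hC⟩ := aux_F G ψ μc hμ K hK i q hq1
  rw [hC _ hsum, hC r hr1]
  change ∑ l, (_ - _ * h l) + C < ∑ l, (r l * Real.log (r l) - r l * h l) + C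
  generalize hsd : crfMfUpdate G ψ μc K q i = s at *
  have hlog : ∀ l, h l = Real.log (s l) + Real.log (∑ m, Real.exp (h m)) := fun l => by
    rw [hs l, Real.log_div (Real.exp_pos _).ne' hZ.ne', Real.log_exp]; ring
  generalize Real.log (∑ m, Real.exp (h m)) = z at hlog
  have hlt : ∑ l, (r l - s l) < ∑ l, (r l * Real.log (r l) - r l * Real.log (s l)) := by
    obtain ⟨l, hl⟩ := Function.ne_iff.1 hne
    exact Finset.sum_lt_sum (fun l _ => (aux_gibbs_s16 _ _ (hr0 l) (hpos l)).1)
      ⟨l, Finset.mem_univ l, (aux_gibbs_s16 _ _ (hr0 l) (hpos l)).2 hl⟩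
  rw [Finset.sum_sub_distrib, hr1, hsum] at hlt
  have f1 : ∑ l, (s l * Real.log (s l) - s l * h l) = -z := by
    have : ∀ l, s l * Real.log (s l) - s l * h l = s l * (-z) := fun l => by
      rw [hlog l]; ring
    simp only [this]
    rw [← Finset.sum_mul, hsum, one_mul]
  have f2 : ∑ l, (r l * Real.log (r l) - r l * h l)
      = ∑ l, (r l * Real.log (r l) - r l * Real.log (s l)) - z := by
    have : ∀ l, r l * Real.log (r l) - r l * h l
        = (r l * Real.log (r l) - r l * Real.log (s l)) - r l * z := fun l => by
      rw [hlog l]; ring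
    simp only [this]
    rw [Finset.sum_sub_distrib, ← Finset.sum_mul, hr1, one_mul]
  rw [f1, f2]
  linarith
end
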